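/- Assume (i) for all r, r' ∈ S, (P^t)(r,r') → π(r') as t → ∞, and (ii) there exists B such that Var(S_τ) ≤ B for every τ ≥ 0 (the variance of the integrated transport is bounded). Then the series ∑_{t=0}^{∞} (C_t − μ²) converges and (E[u(x_0,x_1)²] − μ²)/2 = −∑_{t=0}^{∞} (C_t − μ²). In particular, if Var(u(x_0,x_1)) > 0 then ∑_{t=0}^{∞} (C_t − μ²) < 0: the time correlations of the transport observable are mostly negative (Lemma 5.2). -/

import Mathlib

open Finset

/-- Expectation with respect to the stationary path measure of length `τ`
(paths have `τ + 1` states). -/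
noncomputable def pathE {S : Type*} [Fintype S] (P : S → S → ℝ) (pi : S → ℝ) (τ : ℕ)
    (f : (Fin (τ + 1) → S) → ℝ) : ℝ :=
  ∑ x : Fin (τ + 1) → S,
    (pi (x 0) * ∏ t : Fin τ, P (x t.castSucc) (x t.succ)) * f x

/-- Integrated transport `S_τ = ∑_{t=1}^{τ} u (x_{t-1}, x_t)` along a path. -/
noncomputable def intTrans {S : Type*} (u : S → S → ℝ) (τ : ℕ) (x : Fin (τ + 1) → S) : ℝ :=
  ∑ t : Fin τ, u (x t.castSucc) (x t.succ)

/-- Stationary mean `μ = E[u (x₀, x₁)]`. -/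
noncomputable def mu {S : Type*} [Fintype S] (P : S → S → ℝ) (pi : S → ℝ)
    (u : S → S → ℝ) : ℝ :=
  pathE P pi 1 fun x => u (x 0) (x 1)

/-- Time correlator `C_k = E[u (x₀, x₁) · u (x_{k+1}, x_{k+2})]`. -/
noncomputable def corr {S : Type*} [Fintype S] (P : S → S → ℝ) (pi : S → ℝ)
    (u : S → S → ℝ) (k : ℕ) : ℝ :=
  pathE P pi (k + 2) fun x =>
    u (x 0) (x 1) * u (x ⟨k + 1, by omega⟩) (x ⟨k + 2, by omega⟩)

/-- Variance of the integrated transport `Var(S_τ)`. -/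
noncomputable def varS {S : Type*} [Fintype S] (P : S → S → ℝ) (pi : S → ℝ)
    (u : S → S → ℝ) (τ : ℕ) : ℝ :=
  pathE P pi τ (fun x => (intTrans u τ x) ^ 2)
    - (pathE P pi τ (fun x => intTrans u τ x)) ^ 2

open Matrix Filter Topology

section PathExpectation

variable {S : Type*} [Fintype S] {P : S → S → ℝ} {pi : S → ℝ}

lemma pathE_add (τ : ℕ) (f g : (Fin (τ + 1) → S) → ℝ) :
    pathE P pi τ (fun x => f x + g x) = pathE P pi τ f + pathE P pi τ g := by
  simp only [pathE, mul_add, sum_add_distrib]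

lemma pathE_const_mul (τ : ℕ) (c : ℝ) (f : (Fin (τ + 1) → S) → ℝ) :
    pathE P pi τ (fun x => c * f x) = c * pathE P pi τ f := by
  simp only [pathE, mul_sum]
  exact sum_congr rfl fun x _ => by ring

lemma pathE_nonneg (hP : ∀ r r', 0 ≤ P r r') (hpi : ∀ r, 0 ≤ pi r) (τ : ℕ)
    {f : (Fin (τ + 1) → S) → ℝ} (hf : ∀ x, 0 ≤ f x) : 0 ≤ pathE P pi τ f :=
  sum_nonneg fun x _ =>
    mul_nonneg (mul_nonneg (hpi _) (prod_nonneg fun _ _ => hP _ _)) (hf x)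

/-- Expectation over paths of length `0` is expectation with respect to `pi`. -/
lemma pathE_zero (f : (Fin 1 → S) → ℝ) :
    pathE P pi 0 f = ∑ r, pi r * f (fun _ => r) := by
  unfold pathE
  rw [← (Equiv.funUnique (Fin 1) S).symm.sum_comp]
  refine sum_congr rfl fun r _ => ?_
  rw [Fin.prod_univ_zero, mul_one]
  have h : (Equiv.funUnique (Fin 1) S).symm r = fun _ => r := by
    funext i
    simp
  rw [h]

/-- Markov property: integrate out the last state of a path. -/
lemma pathE_succ (τ : ℕ) (f : (Fin (τ + 2) → S) → ℝ) :
    pathE P pi (τ + 1) f =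
      pathE P pi τ fun x => ∑ z, P (x (Fin.last τ)) z * f (Fin.snoc x z) := by
  unfold pathE
  rw [← (Fin.snocEquiv fun _ : Fin (τ + 2) => S).sum_comp, Fintype.sum_prod_type, sum_comm]
  refine sum_congr rfl fun x _ => ?_
  rw [mul_sum]
  refine sum_congr rfl fun z _ => ?_
  have h0 : (Fin.snoc x z : Fin (τ + 2) → S) 0 = x 0 :=
    Fin.snoc_castSucc (α := fun _ => S) z x 0
  have hs (t : Fin τ) : (Fin.snoc x z : Fin (τ + 2) → S) t.castSucc.succ = x t.succ := by
    rw [← Fin.castSucc_succ]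
    exact Fin.snoc_castSucc (α := fun _ => S) z x t.succ
  simp only [Fin.snocEquiv, Equiv.coe_fn_mk, Fin.prod_univ_castSucc, Fin.succ_last, h0, hs,
    Fin.snoc_castSucc, Fin.snoc_last]
  ring

lemma pathE_one (hProw : ∀ r, ∑ r', P r r' = 1) (hpisum : ∑ r, pi r = 1) (τ : ℕ) :
    pathE P pi τ (fun _ => 1) = 1 := by
  induction τ with
  | zero => simp [pathE_zero, hpisum]
  | succ τ ih => simp [pathE_succ, hProw, ih]

lemma pathE_last (hstat : ∀ r', ∑ r, pi r * P r r' = pi r') (τ : ℕ) (φ : S → ℝ) :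
    pathE P pi τ (fun x => φ (x (Fin.last τ))) = pi ⬝ᵥ φ := by
  induction τ generalizing φ with
  | zero => simp [pathE_zero, dotProduct]
  | succ τ ih =>
    simp only [pathE_succ, Fin.snoc_last]
    rw [ih fun r => ∑ z, P r z * φ z]
    simp only [dotProduct, mul_sum]
    rw [sum_comm]
    refine sum_congr rfl fun z _ => ?_
    rw [← hstat z, sum_mul]
    exact sum_congr rfl fun r _ => by ring

end PathExpectation

lemma intTrans_snoc {S : Type*} (u : S → S → ℝ) (τ : ℕ) (x : Fin (τ + 1) → S) (z : S) :
    intTrans u (τ + 1) (Fin.snoc x z) = intTrans u τ x + u (x (Fin.last τ)) z := by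
  have hs (t : Fin τ) : (Fin.snoc x z : Fin (τ + 2) → S) t.castSucc.succ = x t.succ := by
    rw [← Fin.castSucc_succ]
    exact Fin.snoc_castSucc (α := fun _ => S) z x t.succ
  simp only [intTrans, Fin.sum_univ_castSucc, Fin.succ_last, hs, Fin.snoc_castSucc,
    Fin.snoc_last]

lemma pow_mulVec_one {S : Type*} [Fintype S] [DecidableEq S] {P : S → S → ℝ}
    (hProw : ∀ r, ∑ r', P r r' = 1) (k : ℕ) : of P ^ k *ᵥ (1 : S → ℝ) = 1 := by
  induction k with
  | zero => simp
  | succ k ih =>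
    have h : of P *ᵥ (1 : S → ℝ) = 1 := by
      funext r
      simp [mulVec, dotProduct, hProw]
    rw [pow_succ, ← mulVec_mulVec, h, ih]

section Correlations

variable {S : Type*} [Fintype S]

/-- Mean of the observable over one step started at `r`. -/
noncomputable def stepMean (P u : S → S → ℝ) (r : S) : ℝ := ∑ z, P r z * u r z

/-- Observable integrated over the stationary transitions that end at `r`. -/
noncomputable def entranceMean (P : S → S → ℝ) (pi : S → ℝ) (u : S → S → ℝ) (r : S) : ℝ :=
  ∑ x, pi x * P x r * u x r

variable {P : S → S → ℝ} {pi : S → ℝ} {u : S → S → ℝ}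

lemma pi_dotProduct_stepMean_mul (φ : S → ℝ) :
    (pi ⬝ᵥ fun r => ∑ z, P r z * (u r z * φ z)) = entranceMean P pi u ⬝ᵥ φ := by
  simp only [dotProduct, entranceMean, mul_sum, sum_mul]
  rw [sum_comm]
  exact sum_congr rfl fun z _ => sum_congr rfl fun r _ => by ring

lemma mu_eq_pi_dotProduct : mu P pi u = pi ⬝ᵥ stepMean P u := by
  have h0 (x : Fin 1 → S) (z : S) : (Fin.snoc x z : Fin 2 → S) 0 = x 0 :=
    Fin.snoc_castSucc (α := fun _ => S) z x 0
  have h1 (x : Fin 1 → S) (z : S) : (Fin.snoc x z : Fin 2 → S) 1 = z :=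
    Fin.snoc_last (α := fun _ => S) z x
  simp only [mu, pathE_succ, pathE_zero, h0, h1]
  rfl

lemma mu_eq_sum_entranceMean : mu P pi u = entranceMean P pi u ⬝ᵥ 1 := by
  rw [mu_eq_pi_dotProduct, ← pi_dotProduct_stepMean_mul]
  simp [stepMean, dotProduct]

lemma pathE_one_sq :
    pathE P pi 1 (fun x => (u (x 0) (x 1)) ^ 2) = pi ⬝ᵥ stepMean P fun r z => u r z ^ 2 :=
  mu_eq_pi_dotProduct (u := fun r z => u r z ^ 2)

lemma varS_nonneg (hP : ∀ r r', 0 ≤ P r r') (hProw : ∀ r, ∑ r', P r r' = 1)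
    (hpi : ∀ r, 0 ≤ pi r) (hpisum : ∑ r, pi r = 1) (τ : ℕ) : 0 ≤ varS P pi u τ := by
  set m := pathE P pi τ (fun x => intTrans u τ x) with hm
  have h : 0 ≤ pathE P pi τ (fun x => (intTrans u τ x - m) ^ 2) :=
    pathE_nonneg hP hpi τ fun x => sq_nonneg _
  have he : (fun x => (intTrans u τ x - m) ^ 2) = fun x : Fin (τ + 1) → S =>
      intTrans u τ x ^ 2 + (-(2 * m)) * intTrans u τ x + m ^ 2 * 1 := by
    funext x
    ring
  rw [he, pathE_add, pathE_add, pathE_const_mul, pathE_const_mul, pathE_one hProw hpisum,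
    ← hm] at h
  rw [varS, ← hm]
  linarith

variable [DecidableEq S]

lemma pathE_first_mul_last (k : ℕ) (φ : S → ℝ) :
    pathE P pi (k + 1) (fun x => u (x 0) (x 1) * φ (x (Fin.last (k + 1)))) =
      entranceMean P pi u ⬝ᵥ (of P ^ k *ᵥ φ) := by
  induction k generalizing φ with
  | zero =>
    have h0 (x : Fin 1 → S) (z : S) : (Fin.snoc x z : Fin 2 → S) 0 = x 0 :=
      Fin.snoc_castSucc (α := fun _ => S) z x 0
    have h1 (x : Fin 1 → S) (z : S) : (Fin.snoc x z : Fin 2 → S) 1 = z :=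
      Fin.snoc_last (α := fun _ => S) z x
    rw [pathE_succ]
    simp only [pathE_zero, h0, h1, Fin.snoc_last, pow_zero, one_mulVec]
    exact pi_dotProduct_stepMean_mul φ
  | succ k ih =>
    have h0 (x : Fin (k + 2) → S) (z : S) : (Fin.snoc x z : Fin (k + 3) → S) 0 = x 0 :=
      Fin.snoc_castSucc (α := fun _ => S) z x 0
    have h1 (x : Fin (k + 2) → S) (z : S) : (Fin.snoc x z : Fin (k + 3) → S) 1 = x 1 :=
      Fin.snoc_castSucc (α := fun _ => S) z x 1
    rw [pathE_succ, pow_succ, ← mulVec_mulVec, ← ih]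
    congr 1
    funext x
    simp only [h0, h1, Fin.snoc_last, mulVec, dotProduct, of_apply, mul_sum]
    exact sum_congr rfl fun z _ => by ring

lemma corr_eq (k : ℕ) :
    corr P pi u k = entranceMean P pi u ⬝ᵥ (of P ^ k *ᵥ stepMean P u) := by
  have h0 (x : Fin (k + 2) → S) (z : S) : (Fin.snoc x z : Fin (k + 3) → S) 0 = x 0 :=
    Fin.snoc_castSucc (α := fun _ => S) z x 0
  have h1 (x : Fin (k + 2) → S) (z : S) : (Fin.snoc x z : Fin (k + 3) → S) 1 = x 1 :=
    Fin.snoc_castSucc (α := fun _ => S) z x 1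
  have h2 (x : Fin (k + 2) → S) (z : S) :
      (Fin.snoc x z : Fin (k + 3) → S) ⟨k + 1, by omega⟩ = x (Fin.last (k + 1)) :=
    Fin.snoc_castSucc (α := fun _ => S) z x (Fin.last (k + 1))
  have h3 (x : Fin (k + 2) → S) (z : S) :
      (Fin.snoc x z : Fin (k + 3) → S) ⟨k + 2, by omega⟩ = z :=
    Fin.snoc_last (α := fun _ => S) z x
  rw [← pathE_first_mul_last, corr, pathE_succ]
  congr 1
  funext x
  simp only [h0, h1, h2, h3, stepMean, mul_sum]
  exact sum_congr rfl fun z _ => by ring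

lemma pathE_intTrans_mul_last (hstat : ∀ r', ∑ r, pi r * P r r' = pi r') (τ : ℕ) (φ : S → ℝ) :
    pathE P pi τ (fun x => intTrans u τ x * φ (x (Fin.last τ))) =
      ∑ k ∈ range τ, entranceMean P pi u ⬝ᵥ (of P ^ k *ᵥ φ) := by
  induction τ generalizing φ with
  | zero => simp [pathE_zero, intTrans]
  | succ τ ih =>
    have hsplit : pathE P pi (τ + 1)
          (fun x => intTrans u (τ + 1) x * φ (x (Fin.last (τ + 1)))) =
        pathE P pi τ (fun x => intTrans u τ x * (of P *ᵥ φ) (x (Fin.last τ)) +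
          ∑ z, P (x (Fin.last τ)) z * (u (x (Fin.last τ)) z * φ z)) := by
      rw [pathE_succ]
      congr 1
      funext x
      simp only [intTrans_snoc, Fin.snoc_last, mulVec, dotProduct, of_apply, mul_sum,
        ← sum_add_distrib]
      exact sum_congr rfl fun z _ => by ring
    rw [hsplit, pathE_add, ih,
      pathE_last hstat τ fun r => ∑ z, P r z * (u r z * φ z),
      pi_dotProduct_stepMean_mul, sum_range_succ']
    simp [pow_succ, mulVec_mulVec]

lemma pathE_intTrans (hProw : ∀ r, ∑ r', P r r' = 1)
    (hstat : ∀ r', ∑ r, pi r * P r r' = pi r') (τ : ℕ) :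
    pathE P pi τ (fun x => intTrans u τ x) = τ * mu P pi u := by
  have h := pathE_intTrans_mul_last (u := u) hstat τ 1
  simpa [pow_mulVec_one hProw, ← mu_eq_sum_entranceMean] using h

lemma pathE_intTrans_sq_succ (hProw : ∀ r, ∑ r', P r r' = 1)
    (hstat : ∀ r', ∑ r, pi r * P r r' = pi r') (τ : ℕ) :
    pathE P pi (τ + 1) (fun x => intTrans u (τ + 1) x ^ 2) =
      pathE P pi τ (fun x => intTrans u τ x ^ 2) + 2 * ∑ k ∈ range τ, corr P pi u k +
        pathE P pi 1 (fun x => (u (x 0) (x 1)) ^ 2) := by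
  have hsplit : pathE P pi (τ + 1) (fun x => intTrans u (τ + 1) x ^ 2) =
      pathE P pi τ (fun x => intTrans u τ x ^ 2 +
        2 * (intTrans u τ x * stepMean P u (x (Fin.last τ))) +
        stepMean P (fun r z => u r z ^ 2) (x (Fin.last τ))) := by
    rw [pathE_succ]
    congr 1
    funext x
    have hx : intTrans u τ x ^ 2 = ∑ z, P (x (Fin.last τ)) z * intTrans u τ x ^ 2 := by
      rw [← sum_mul, hProw, one_mul]
    rw [hx]
    simp only [intTrans_snoc, stepMean, mul_sum, ← sum_add_distrib]
    exact sum_congr rfl fun z _ => by ring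
  rw [hsplit, pathE_add, pathE_add, pathE_const_mul, pathE_intTrans_mul_last hstat,
    pathE_last hstat, pathE_one_sq]
  simp only [corr_eq]

/-- The variance of the integrated transport is a double partial sum of the correlations. -/
lemma varS_eq_sum (hProw : ∀ r, ∑ r', P r r' = 1)
    (hstat : ∀ r', ∑ r, pi r * P r r' = pi r') (τ : ℕ) :
    varS P pi u τ = ∑ n ∈ range τ,
      (pathE P pi 1 (fun x => (u (x 0) (x 1)) ^ 2) - mu P pi u ^ 2 +
        2 * ∑ k ∈ range n, (corr P pi u k - mu P pi u ^ 2)) := by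
  induction τ with
  | zero => simp [varS, pathE_zero, intTrans]
  | succ τ ih =>
    rw [sum_range_succ, ← ih]
    simp only [varS, pathE_intTrans_sq_succ hProw hstat, pathE_intTrans hProw hstat,
      sum_sub_distrib, sum_const, card_range, nsmul_eq_mul]
    push_cast
    ring

end Correlations

section PoissonEquation

variable {S : Type*} [Fintype S] [DecidableEq S] {P : S → S → ℝ} {pi : S → ℝ}

lemma tendsto_pow_mulVec
    (hconv : ∀ r r', Tendsto (fun t : ℕ => (of P ^ t) r r') atTop (𝓝 (pi r')))
    (f : S → ℝ) (r : S) :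
    Tendsto (fun t : ℕ => (of P ^ t *ᵥ f) r) atTop (𝓝 (pi ⬝ᵥ f)) :=
  tendsto_finsetSum _ fun r' _ => (hconv r r').mul_const (f r')

/-- For a mixing chain the Poisson equation is solvable for every centred right-hand side. -/
lemma exists_poisson_solution (hpisum : ∑ r, pi r = 1)
    (hstat : ∀ r', ∑ r, pi r * P r r' = pi r')
    (hconv : ∀ r r', Tendsto (fun t : ℕ => (of P ^ t) r r') atTop (𝓝 (pi r')))
    {g : S → ℝ} (hg : pi ⬝ᵥ g = 0) : ∃ f : S → ℝ, f - of P *ᵥ f = g := by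
  have hpiP (v : S → ℝ) : pi ⬝ᵥ (of P *ᵥ v) = pi ⬝ᵥ v := by
    rw [dotProduct_mulVec]
    congr 1
    exact funext hstat
  let L : (S → ℝ) →ₗ[ℝ] (S → ℝ) :=
    { toFun := fun v => v - of P *ᵥ v + fun _ => pi ⬝ᵥ v
      map_add' := fun v w => by
        funext r
        simp only [mulVec_add, dotProduct_add, Pi.add_apply, Pi.sub_apply]
        ring
      map_smul' := fun c v => by
        funext r
        simp only [mulVec_smul, dotProduct_smul, Pi.add_apply, Pi.sub_apply, Pi.smul_apply,
          smul_eq_mul, RingHom.id_apply]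
        ring }
  have hL (v : S → ℝ) : L v = v - of P *ᵥ v + fun _ => pi ⬝ᵥ v := rfl
  have hpiL (v : S → ℝ) : pi ⬝ᵥ L v = pi ⬝ᵥ v := by
    have hc : (pi ⬝ᵥ fun _ => pi ⬝ᵥ v) = pi ⬝ᵥ v := by
      change ∑ r, pi r * (pi ⬝ᵥ v) = _
      rw [← sum_mul, hpisum, one_mul]
    rw [hL, dotProduct_add, dotProduct_sub, hpiP, hc, sub_self, zero_add]
  have hsub {v : S → ℝ} (hv : pi ⬝ᵥ v = 0) : L v = v - of P *ᵥ v := by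
    funext r
    simp [hL, hv]
  have hinj : Function.Injective L := by
    rw [injective_iff_map_eq_zero]
    intro v hv
    have hpv : pi ⬝ᵥ v = 0 := by rw [← hpiL, hv, dotProduct_zero]
    have hfix : of P *ᵥ v = v := by
      rw [hsub hpv, sub_eq_zero] at hv
      exact hv.symm
    have hpow (t : ℕ) : of P ^ t *ᵥ v = v := by
      induction t with
      | zero => simp
      | succ t ih => rw [pow_succ, ← mulVec_mulVec, hfix, ih]
    funext r
    have ht := tendsto_pow_mulVec hconv v r
    simp only [hpow, hpv] at ht
    exact tendsto_nhds_unique tendsto_const_nhds ht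
  obtain ⟨f, hf⟩ := LinearMap.surjective_of_injective hinj g
  refine ⟨f, ?_⟩
  rw [← hsub (by rw [← hpiL, hf, hg]), hf]

lemma exists_tendsto_sum_pow_mulVec (hpisum : ∑ r, pi r = 1)
    (hstat : ∀ r', ∑ r, pi r * P r r' = pi r')
    (hconv : ∀ r r', Tendsto (fun t : ℕ => (of P ^ t) r r') atTop (𝓝 (pi r')))
    {g : S → ℝ} (hg : pi ⬝ᵥ g = 0) (h : S → ℝ) :
    ∃ l, Tendsto (fun n : ℕ => ∑ t ∈ range n, h ⬝ᵥ (of P ^ t *ᵥ g)) atTop (𝓝 l) := by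
  obtain ⟨f, rfl⟩ := exists_poisson_solution hpisum hstat hconv hg
  have htel (n : ℕ) : ∑ t ∈ range n, h ⬝ᵥ (of P ^ t *ᵥ (f - of P *ᵥ f)) =
      h ⬝ᵥ f - h ⬝ᵥ (of P ^ n *ᵥ f) := by
    have := sum_range_sub' (fun t => h ⬝ᵥ (of P ^ t *ᵥ f)) n
    simpa [mulVec_sub, mulVec_mulVec, dotProduct_sub, pow_succ] using this
  simp only [htel]
  exact ⟨_, tendsto_const_nhds.sub
    (tendsto_finsetSum _ fun r _ => (tendsto_pow_mulVec hconv f r).const_mul (h r))⟩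

end PoissonEquation

/-- The centred correlations of a mixing chain are summable in the order of time. -/
lemma exists_tendsto_sum_corr {S : Type*} [Fintype S] [DecidableEq S]
    {P : S → S → ℝ} {pi : S → ℝ} (u : S → S → ℝ)
    (hProw : ∀ r, ∑ r', P r r' = 1) (hpisum : ∑ r, pi r = 1)
    (hstat : ∀ r', ∑ r, pi r * P r r' = pi r')
    (hconv : ∀ r r', Tendsto (fun t : ℕ => (of P ^ t) r r') atTop (𝓝 (pi r'))) :
    ∃ l, Tendsto (fun n : ℕ => ∑ t ∈ range n, (corr P pi u t - mu P pi u ^ 2))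
      atTop (𝓝 l) := by
  have hg : pi ⬝ᵥ (stepMean P u - mu P pi u • (1 : S → ℝ)) = 0 := by
    rw [dotProduct_sub, dotProduct_smul, dotProduct_one, hpisum, ← mu_eq_pi_dotProduct]
    simp
  obtain ⟨l, hl⟩ :=
    exists_tendsto_sum_pow_mulVec hpisum hstat hconv hg (entranceMean P pi u)
  refine ⟨l, hl.congr fun n => sum_congr rfl fun t _ => ?_⟩
  rw [corr_eq, mulVec_sub, mulVec_smul, pow_mulVec_one hProw, dotProduct_sub, dotProduct_smul,
    ← mu_eq_sum_entranceMean, smul_eq_mul, sq]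

/-- Lemma 5.2 (time transport correlation): if `(P^t)(r,r') → π(r')` and the variance
of the integrated transport is bounded, then the series `∑_{t≥0} (C_t - μ²)` converges,
`(E[u(x₀,x₁)²] - μ²)/2 = -∑_{t≥0} (C_t - μ²)`, and if `Var(u(x₀,x₁)) > 0` then
`∑_{t≥0} (C_t - μ²) < 0` (the time correlations are mostly negative). -/
theorem mostly_negative_time_correlations
    {S : Type*} [Fintype S] [DecidableEq S] [Nonempty S]
    (P : S → S → ℝ) (pi : S → ℝ) (u : S → S → ℝ)
    (hP : ∀ r r', 0 ≤ P r r') (hProw : ∀ r, ∑ r', P r r' = 1)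
    (hpi : ∀ r, 0 ≤ pi r) (hpisum : ∑ r, pi r = 1)
    (hstat : ∀ r', ∑ r, pi r * P r r' = pi r')
    (hconv : ∀ r r', Filter.Tendsto (fun t : ℕ => ((Matrix.of P) ^ t) r r')
      Filter.atTop (nhds (pi r')))
    (B : ℝ) (hB : ∀ τ : ℕ, varS P pi u τ ≤ B) :
    ∃ l : ℝ,
      Filter.Tendsto
        (fun n : ℕ => ∑ t ∈ Finset.range n, (corr P pi u t - (mu P pi u) ^ 2))
        Filter.atTop (nhds l) ∧
      (pathE P pi 1 (fun x => (u (x 0) (x 1)) ^ 2) - (mu P pi u) ^ 2) / 2 = -l ∧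
      (0 < pathE P pi 1 (fun x => (u (x 0) (x 1)) ^ 2) - (mu P pi u) ^ 2 → l < 0) := by
  obtain ⟨l, hl⟩ := exists_tendsto_sum_corr u hProw hpisum hstat hconv
  have hces := (((hl.const_mul 2).const_add
    (pathE P pi 1 (fun x => (u (x 0) (x 1)) ^ 2) - mu P pi u ^ 2))).cesaro
  simp only [← varS_eq_sum hProw hstat] at hces
  have hzero : Tendsto (fun n : ℕ => (n : ℝ)⁻¹ * varS P pi u n) atTop (𝓝 0) := by
    refine squeeze_zero
      (fun n => mul_nonneg (by positivity) (varS_nonneg hP hProw hpi hpisum n))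
      (fun n => mul_le_mul_of_nonneg_left (hB n) (by positivity)) ?_
    simpa using (tendsto_inv_atTop_nhds_zero_nat (𝕜 := ℝ)).mul_const B
  have hlim := tendsto_nhds_unique hces hzero
  exact ⟨l, hl, by linarith, fun hpos => by linarith⟩
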